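/- Let q be an odd prime power, d ≥ 2, and E ⊆ 𝔽_q^d. Then C_{2k+1} = q^{−1}·C_k^2 + R_{2k+1}, where |R_{2k+1}| ≤ 2·q^{(d−1)/2}·C_{2k}. -/

import Mathlib

/-- `C_n`: the number of unit-distance chains of length `n` in `E ⊆ 𝔽_q^d`, i.e. tuples
`(x^1, …, x^{n+1}) ∈ E^{n+1}` with `‖x^i − x^{i+1}‖ = 1` for `1 ≤ i ≤ n`,
where `‖x‖ = x_1^2 + ⋯ + x_d^2`. -/
def chainCount {F : Type} [Field F] [Fintype F] [DecidableEq F] {d : ℕ}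
    (E : Finset (Fin d → F)) (n : ℕ) : ℕ :=
  (Finset.univ.filter (fun x : Fin (n + 1) → (Fin d → F) =>
    (∀ i, x i ∈ E) ∧ ∀ i : Fin n, ∑ j, (x i.castSucc j - x i.succ j) ^ 2 = 1)).card

section
open Polynomial

lemma biv_zero {k : Type} [Field k] (r : ℕ) (P : k[X][X])
    (hP : ∀ i, (P.coeff i).degree < r) (h : P.eval (X ^ r) = 0) : P = 0 := by
  ext i s
  simp only [coeff_zero]
  rcases lt_or_ge s r with hs | hs
  · have h1 : (P.eval (X ^ r)).coeff (r * i + s) = (P.coeff i).coeff s := by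
      rw [eval_eq_sum_range, finsetSum_coeff]
      have : ∀ j ∈ Finset.range (P.natDegree + 1),
          (P.coeff j * (X ^ r) ^ j).coeff (r * i + s) = if j = i then (P.coeff i).coeff s else 0 := by
        intro j _
        rw [← pow_mul, coeff_mul_X_pow']
        split_ifs with h1 h2 h2
        · subst h2; simp
        · apply coeff_eq_zero_of_degree_lt
          refine lt_of_lt_of_le (hP j) ?_
          have : j < i := by
            by_contra hc
            have : i + 1 ≤ j := by omega
            have := Nat.mul_le_mul_left r this
            rw [mul_add] at this
            omega
          have := Nat.mul_le_mul_left r this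
          rw [Nat.succ_eq_add_one, mul_add] at this
          exact_mod_cast (by omega)
        · subst h2; omega
        · rfl
      rw [Finset.sum_congr rfl this, Finset.sum_ite_eq']
      split_ifs with h2
      · rfl
      · rw [coeff_eq_zero_of_natDegree_lt (n := i)]
        · simp
        · simpa using h2
    rw [← h1, h, coeff_zero]
  · apply coeff_eq_zero_of_degree_lt
    exact lt_of_lt_of_le (hP i) (by exact_mod_cast hs)

lemma biv_deg_mul {k : Type} [Field k] (A B : k[X][X]) (s t : ℕ)
    (hA : ∀ i, (A.coeff i).natDegree ≤ s) (hB : ∀ i, (B.coeff i).natDegree ≤ t) (i : ℕ) :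
    ((A * B).coeff i).natDegree ≤ s + t := by
  rw [coeff_mul]
  apply natDegree_sum_le_of_forall_le
  intro x _
  exact natDegree_mul_le.trans (Nat.add_le_add (hA _) (hB _))

lemma sq_contra {k : Type} [Field k] (D E : k[X]) (hD : Squarefree D) (hD0 : ¬ IsUnit D) (hE : E ≠ 0)
    (A B : k[X][X]) (h : C D * A ^ 2 = E.map C * B ^ 2) : A = 0 ∧ B = 0 := by
  have hDne : D ≠ 0 := hD.ne_zero
  obtain ⟨π, hπ, hd⟩ := WfDvdMonoid.exists_irreducible_factor hD0 hDne
  have hp : Prime (C π : k[X][X]) := prime_C_iff.2 hπ.prime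
  have hEm : E.map (C : k →+* k[X]) ≠ 0 := by
    rwa [Ne, Polynomial.map_eq_zero_iff C_injective]
  have key : A ≠ 0 → B ≠ 0 → False := by
    intro hA hB
    have e := congrArg (emultiplicity (C π)) h
    rw [emultiplicity_mul hp, emultiplicity_mul hp, emultiplicity_pow hp, emultiplicity_pow hp] at e
    have hA' : FiniteMultiplicity (C π) A := FiniteMultiplicity.of_prime_left hp hA
    have hB' : FiniteMultiplicity (C π) B := FiniteMultiplicity.of_prime_left hp hB
    have h1 : emultiplicity (C π) (C D) = 1 := by
      have : emultiplicity (C π) (C D) = ((1:ℕ) : ℕ∞) := by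
        rw [emultiplicity_eq_coe]
        refine ⟨by simpa using _root_.map_dvd (C : k[X] →+* k[X][X]) hd, ?_⟩
        intro h2
        rw [← C_pow, C_dvd_iff_dvd_coeff] at h2
        have := h2 0
        simp only [coeff_C_zero] at this
        apply hπ.not_isUnit
        apply hD
        rw [← sq]; exact this
      simpa using this
    have h0 : emultiplicity (C π) (E.map (C : k →+* k[X])) = 0 := by
      rw [emultiplicity_eq_zero]
      intro h2
      rw [C_dvd_iff_dvd_coeff] at h2
      have := h2 E.natDegree
      rw [coeff_map] at this
      apply hπ.not_isUnit
      apply isUnit_of_dvd_unit this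
      rw [isUnit_C]
      exact (leadingCoeff_ne_zero.2 hE).isUnit
    rw [h1, h0, hA'.emultiplicity_eq_multiplicity, hB'.emultiplicity_eq_multiplicity] at e
    norm_cast at e
    omega
  by_cases hA : A = 0
  · subst hA
    refine ⟨rfl, ?_⟩
    by_contra hB
    have : E.map (C : k →+* k[X]) * B ^ 2 ≠ 0 := mul_ne_zero hEm (pow_ne_zero _ hB)
    apply this; rw [← h]; simp
  · exfalso
    apply key hA
    rintro rfl
    have : C D * A ^ 2 ≠ 0 := mul_ne_zero (by simpa using hDne) (pow_ne_zero _ hA)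
    apply this; rw [h]; simp

lemma H_ne {k : Type} [Field k] (p e r : ℕ) [Fact p.Prime] [CharP k p] (hr : r = p ^ e) (hodd : Odd r)
    (D : k[X]) (hD : Squarefree D) (hD0 : ¬ IsUnit D) (l : ℕ) (hl : D.natDegree + 2 * l < r)
    (A B : k[X][X]) (hA : ∀ i, (A.coeff i).natDegree ≤ l) (hB : ∀ i, (B.coeff i).natDegree ≤ l)
    (h : A.eval (X ^ r) + D ^ ((r - 1) / 2) * B.eval (X ^ r) = 0) : A = 0 ∧ B = 0 := by
  set E := D.map (iterateFrobenius k p e) with hE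
  have hE0 : E ≠ 0 := by
    rw [hE, Ne, Polynomial.map_eq_zero_iff (iterateFrobenius k p e).injective]
    exact hD.ne_zero
  have hev : (E.map (C : k →+* k[X])).eval (X ^ r) = D ^ r := by
    have := Polynomial.map_iterateFrobenius_expand p D e
    rw [eval_map, hr, ← this, map_expand]
    rfl
  apply sq_contra D E hD hD0 hE0
  rw [← sub_eq_zero]
  apply biv_zero r
  · intro i
    apply lt_of_le_of_lt degree_le_natDegree
    have : ((C D * A ^ 2 - E.map C * B ^ 2).coeff i).natDegree ≤ D.natDegree + (l + l) := by
      rw [coeff_sub]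
      refine (natDegree_sub_le _ _).trans (max_le ?_ ?_)
      · apply biv_deg_mul
        · intro i; rw [coeff_C]; split_ifs <;> simp
        · rw [sq]; exact biv_deg_mul _ _ _ _ hA hA
      · apply biv_deg_mul
        · intro i; rw [coeff_map]; simp
        · rw [sq]; exact biv_deg_mul _ _ _ _ hB hB
    exact_mod_cast (by omega)
  · rw [eval_sub, eval_mul, eval_mul, eval_pow, eval_pow, hev, eval_C]
    have h1 : A.eval (X ^ r) = - (D ^ ((r - 1) / 2) * B.eval (X ^ r)) := eq_neg_of_add_eq_zero_left h
    rw [h1]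
    obtain ⟨s, hs⟩ := hodd
    have : (r - 1) / 2 = s := by omega
    rw [this, hs]; ring

lemma exists_rel {k ι : Type} [Field k] [Fintype ι] (N : ℕ) (v : ι → k[X]) (hv : ∀ i, (v i).degree < N)
    (hN : N < Fintype.card ι) : ∃ c : ι → k, c ≠ 0 ∧ ∑ i, c i • v i = 0 := by
  let f : (ι → k) →ₗ[k] (Fin N → k) :=
    (LinearMap.pi fun n : Fin N => lcoeff k (n : ℕ)) ∘ₗ Fintype.linearCombination k v
  have : LinearMap.ker f ≠ ⊥ := by
    apply LinearMap.ker_ne_bot_of_finrank_lt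
    simpa using hN
  obtain ⟨c, hc, hc0⟩ := (Submodule.ne_bot_iff _).1 this
  refine ⟨c, hc0, ?_⟩
  rw [LinearMap.mem_ker] at hc
  ext n
  rw [coeff_zero]
  rcases lt_or_ge n N with h | h
  · have := congrFun hc ⟨n, h⟩
    simpa [f, Fintype.linearCombination_apply] using this
  · apply coeff_eq_zero_of_degree_lt
    refine lt_of_lt_of_le (b := (N : WithBot ℕ)) ?_ (by exact_mod_cast h)
    rw [← mem_degreeLT]
    apply Submodule.sum_mem
    intro i _
    exact Submodule.smul_mem _ _ (mem_degreeLT.2 (hv i))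

lemma stepanov {k : Type} [Field k] [Fintype k] [DecidableEq k]
    (p e r : ℕ) [Fact p.Prime] [CharP k p] (hr : r = p ^ e) (hodd : Odd r)
    (hcard : Fintype.card k = r ^ 2)
    (D : k[X]) (hD : Squarefree D) (hD0 : ¬ IsUnit D) (l m : ℕ) (hl : D.natDegree + 2 * l < r)
    (hm : r * l + m + (r - 1) / 2 * D.natDegree < 2 * (m * (l + 1)))
    (ε : k) (hε : ε ≠ 0) :
    (Finset.univ.filter fun y : k => (D.eval y) ^ ((r ^ 2 - 1) / 2) = ε).card
      ≤ l + r * m + (r - 1) / 2 * D.natDegree := by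
  set s := (r - 1) / 2 with hs
  have hm0 : 0 < m := by
    rcases Nat.eq_zero_or_pos m with h | h
    · subst h; simp at hm
    · exact h
  have hDn : D ≠ 0 := hD.ne_zero
  have hDs : (D ^ s).natDegree = s * D.natDegree := natDegree_pow _ _
  let v : (Fin m × Fin (l + 1)) ⊕ (Fin m × Fin (l + 1)) → k[X] :=
    Sum.elim (fun x => X ^ (r * x.2 + x.1 : ℕ) * D ^ s) (fun x => ε • X ^ (r * x.2 + x.1 : ℕ))
  have hidx : ∀ x : Fin m × Fin (l + 1), r * (x.2 : ℕ) + x.1 < r * l + m := by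
    intro x
    have h1 := Nat.mul_le_mul_left r (Nat.lt_succ_iff.1 x.2.2)
    have h2 := x.1.2
    omega
  obtain ⟨c, hc0, hc⟩ := exists_rel (r * l + m + s * D.natDegree) v (by
      rintro (x | x)
      · simp only [v, Sum.elim_inl]
        refine lt_of_le_of_lt degree_le_natDegree ?_
        have : (X ^ (r * x.2 + x.1 : ℕ) * D ^ s).natDegree ≤ (r * x.2 + x.1 : ℕ) + s * D.natDegree := by
          refine natDegree_mul_le.trans ?_
          rw [natDegree_X_pow, hDs]
        have h2 := hidx x
        exact_mod_cast (by omega)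
      · simp only [v, Sum.elim_inr]
        refine lt_of_le_of_lt (degree_smul_le _ _) ?_
        rw [degree_X_pow]
        have h2 := hidx x
        exact_mod_cast (by omega)) (by simpa [two_mul] using hm)
  let mk : (Fin m × Fin (l + 1) → k) → k[X][X] := fun α =>
    ∑ x, monomial (x.1 : ℕ) (monomial (x.2 : ℕ) (α x ^ r))
  have mk_coeff : ∀ α x, ((mk α).coeff (x.1 : Fin m)).coeff (x.2 : Fin (l+1)) = α x ^ r := by
    intro α x
    simp only [mk, finsetSum_coeff, coeff_monomial]
    rw [Finset.sum_eq_single x]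
    · simp
    · intro y _ hy
      split_ifs with h
      · rw [coeff_monomial]
        split_ifs with h'
        · exact absurd (Prod.ext (Fin.ext h) (Fin.ext h')) hy
        · rfl
      · simp
    · simp
  have mk_deg : ∀ α i, ((mk α).coeff i).natDegree ≤ l := by
    intro α i
    simp only [mk, finsetSum_coeff, coeff_monomial]
    apply natDegree_sum_le_of_forall_le
    intro x _
    split_ifs
    · exact (natDegree_monomial_le _).trans (Nat.lt_succ_iff.1 x.2.2)
    · simp
  have mk_eval : ∀ α, (mk α).eval (X ^ r) = ∑ x, monomial (x.2 + r * x.1 : ℕ) (α x ^ r) := by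
    intro α
    simp only [mk, eval_finsetSum, eval_monomial]
    refine Finset.sum_congr rfl fun x _ => ?_
    rw [← pow_mul, monomial_mul_X_pow]
  have mk_ne : ∀ α, mk α = 0 → α = 0 := by
    intro α h
    funext x
    have := mk_coeff α x
    rw [h] at this
    simp only [coeff_zero] at this
    exact eq_zero_of_pow_eq_zero this.symm
  set α := fun x => c (Sum.inl x)
  set β := fun x => c (Sum.inr x)
  set H := (mk α).eval (X ^ r) + D ^ s * (mk β).eval (X ^ r) with hH
  have hH0 : H ≠ 0 := by
    intro h
    obtain ⟨h1, h2⟩ := H_ne p e r hr hodd D hD hD0 l hl (mk α) (mk β) (mk_deg α) (mk_deg β) h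
    apply hc0
    funext x
    rcases x with x | x
    · exact congrFun (mk_ne _ h1) x
    · exact congrFun (mk_ne _ h2) x
  have mk_nat : ∀ α, ((mk α).eval (X ^ r)).natDegree ≤ l + r * m := by
    intro α
    rw [mk_eval]
    apply natDegree_sum_le_of_forall_le
    intro x _
    refine (natDegree_monomial_le _).trans ?_
    exact Nat.add_le_add (Nat.lt_succ_iff.1 x.2.2) (Nat.mul_le_mul_left r x.1.2.le)
  have hHdeg : H.natDegree ≤ l + r * m + s * D.natDegree := by
    refine (natDegree_add_le _ _).trans (max_le ((mk_nat _).trans (by omega)) ?_)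
    refine natDegree_mul_le.trans ?_
    rw [hDs]
    have := mk_nat β
    omega
  refine le_trans ?_ hHdeg
  refine le_trans ?_ (card_roots' H)
  refine le_trans ?_ (Multiset.toFinset_card_le _)
  apply Finset.card_le_card
  intro y hy
  rw [Finset.mem_filter] at hy
  rw [Multiset.mem_toFinset, mem_roots hH0, IsRoot.def]
  have hy := hy.2
  have hyQ : ∀ z : k, z ^ (r * r) = z := by
    intro z
    rw [← sq, ← hcard, FiniteField.pow_card]
  have fr : ∀ z : k, z ^ r = iterateFrobenius k p e z := by
    intro z; rw [iterateFrobenius_def, hr]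
  have mk_pow : ∀ α, (((mk α).eval (X ^ r)).eval y) ^ r = ∑ x, α x * y ^ (r * x.2 + x.1 : ℕ) := by
    intro α
    rw [mk_eval, eval_finsetSum, fr, map_sum]
    refine Finset.sum_congr rfl fun x _ => ?_
    rw [← fr, eval_monomial, mul_pow, ← pow_mul, hyQ, ← pow_mul, add_mul, pow_add, pow_add,
      show r * (x.1 : ℕ) * r = (r * r) * x.1 by ring, pow_mul y (r * r), hyQ, mul_comm (x.2 : ℕ) r]
  have hT := congrArg (eval y) hc
  simp only [Fintype.sum_sum_type, v, Sum.elim_inl, Sum.elim_inr, eval_add, eval_finsetSum,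
    eval_smul, eval_mul, eval_pow, eval_X, eval_zero, smul_eq_mul] at hT
  have hDy : D.eval y ≠ 0 := by
    intro h
    rw [h] at hy
    rcases Nat.eq_zero_or_pos ((r ^ 2 - 1) / 2) with h0 | h0
    · have : 3 ≤ r := by
        obtain ⟨t, ht⟩ := hodd
        have : D.natDegree ≠ 0 := by
          intro h
          apply hD0
          exact isUnit_iff_degree_eq_zero.2 ((degree_eq_iff_natDegree_eq hDn).2 h)
        omega
      have : 9 ≤ r ^ 2 := by nlinarith
      omega
    · rw [zero_pow h0.ne'] at hy
      exact hε hy.symm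
  have hexp : s * r + s = (r ^ 2 - 1) / 2 := by
    obtain ⟨t, ht⟩ := hodd
    have : s = t := by omega
    rw [this, ht, show (2 * t + 1) ^ 2 - 1 = 2 * (t * (2 * t + 1) + t) by
      rw [show (2 * t + 1) ^ 2 = 2 * (t * (2 * t + 1) + t) + 1 by ring]; rfl]
    simp
  have hfin : (D.eval y) ^ s * (H.eval y) ^ r = 0 := by
    rw [hH, eval_add, eval_mul, eval_pow, fr, map_add, ← fr, ← fr, mul_pow, mk_pow, mk_pow, ← hT,
      mul_add, ← pow_mul, ← mul_assoc, ← pow_add, add_comm s, hexp, hy, Finset.mul_sum, Finset.mul_sum]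
    congr 1 <;> refine Finset.sum_congr rfl fun x _ => ?_
    · simp only [α]; ring
    · simp only [β]; ring
  rcases mul_eq_zero.1 hfin with h | h
  · exact absurd (eq_zero_of_pow_eq_zero h) hDy
  · exact eq_zero_of_pow_eq_zero h

lemma ringChar_ne_two_of_odd {k : Type} [Field k] [Fintype k] (h : Odd (Fintype.card k)) :
    ringChar k ≠ 2 := by
  intro h2
  have := FiniteField.even_card_of_char_two h2
  rw [← Nat.even_iff] at this
  exact (Nat.not_even_iff_odd.2 h) this

lemma quad_sum_bound {k : Type} [Field k] [Fintype k] [DecidableEq k]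
    (p e r : ℕ) [Fact p.Prime] [CharP k p] (hr : r = p ^ e) (hodd : Odd r)
    (hcard : Fintype.card k = r ^ 2)
    (D : k[X]) (hD : Squarefree D) (hD0 : ¬ IsUnit D) (hbig : 2 * D.natDegree + 1 ≤ r) :
    |∑ y : k, quadraticChar k (D.eval y)| ≤ (r : ℤ) * (5 * D.natDegree + 4) := by
  obtain ⟨t, ht⟩ := id hodd
  set δ := D.natDegree with hδ
  have hs : (r - 1) / 2 = t := by omega
  have hch : ringChar k ≠ 2 := ringChar_ne_two_of_odd (by rw [hcard]; exact hodd.pow)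
  have key : ∀ ε : k, ε ≠ 0 →
      2 * (Finset.univ.filter fun y : k => (D.eval y) ^ ((r ^ 2 - 1) / 2) = ε).card
        ≤ r ^ 2 + r * (4 * δ + 4) := by
    intro ε hε
    have h := stepanov p e r hr hodd hcard D hD hD0 (t / 2) (t + 1 + δ) (by omega) (by
      rw [hs, ← hδ, ht]
      obtain ⟨l, hl⟩ : ∃ l, l = t / 2 := ⟨_, rfl⟩
      rw [← hl]
      have h1 : t ≤ 2 * l + 1 := by omega
      have h2 : δ ≤ t := by omega
      have h3 : t * δ ≤ (2 * l + 1) * δ := Nat.mul_le_mul_right _ h1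
      nlinarith) ε hε
    rw [hs, ← hδ] at h
    have h4 : t / 2 ≤ r := by omega
    have h5 : 2 * t ≤ r := by omega
    have h6 : 2 * t * δ ≤ r * δ := Nat.mul_le_mul_right _ h5
    have h7 : r * (2 * t) ≤ r * r := Nat.mul_le_mul_left _ h5
    nlinarith
  have hsq : r ^ 2 / 2 = (r ^ 2 - 1) / 2 := by
    obtain ⟨u, hu⟩ := hodd.pow (n := 2)
    omega
  have hne : (1 : k) ≠ -1 := (Ring.neg_one_ne_one_of_char_ne_two hch).symm
  have hval : ∀ y : k, quadraticChar k (D.eval y) =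
      (if (D.eval y) ^ ((r ^ 2 - 1) / 2) = 1 then (1 : ℤ) else 0) -
      (if (D.eval y) ^ ((r ^ 2 - 1) / 2) = -1 then (1 : ℤ) else 0) := by
    intro y
    have h := quadraticChar_eq_pow_of_char_ne_two' hch (D.eval y)
    rw [hcard, hsq] at h
    rw [← h]
    rcases eq_or_ne (D.eval y) 0 with h0 | h0
    · rw [h0]; simp
    · rcases quadraticChar_dichotomy h0 with h1 | h1 <;> rw [h1]
      · simp [hne]
      · simp [hne.symm]
  have hval2 : ∀ y : k, (1 : ℤ) ≤
      (if (D.eval y) ^ ((r ^ 2 - 1) / 2) = 1 then (1 : ℤ) else 0) +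
      (if (D.eval y) ^ ((r ^ 2 - 1) / 2) = -1 then (1 : ℤ) else 0) +
      (if D.eval y = 0 then (1 : ℤ) else 0) := by
    intro y
    have h := quadraticChar_eq_pow_of_char_ne_two' hch (D.eval y)
    rw [hcard, hsq] at h
    rw [← h]
    rcases eq_or_ne (D.eval y) 0 with h0 | h0
    · rw [h0]; simp
    · rcases quadraticChar_dichotomy h0 with h1 | h1 <;> rw [h1]
      · simp [hne, h0]
      · simp [hne.symm, h0]
  have hz : (Finset.univ.filter fun y : k => D.eval y = 0).card ≤ δ := by
    refine le_trans ?_ (card_roots' D)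
    refine le_trans ?_ (Multiset.toFinset_card_le _)
    apply Finset.card_le_card
    intro y hy
    rw [Finset.mem_filter] at hy
    rw [Multiset.mem_toFinset, mem_roots hD.ne_zero, IsRoot.def]
    exact hy.2
  have hsum2 := Finset.sum_le_sum fun y (_ : y ∈ (Finset.univ : Finset k)) => hval2 y
  rw [Finset.sum_congr rfl fun y _ => hval y]
  simp only [Finset.sum_add_distrib, Finset.sum_sub_distrib, Finset.sum_boole, Finset.sum_const,
    Finset.card_univ, hcard] at hsum2 ⊢
  have k1 := key 1 one_ne_zero
  have k2 := key (-1) (neg_ne_zero.2 one_ne_zero)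
  have h8 : δ ≤ r * δ := Nat.le_mul_of_pos_left _ (by omega)
  zify at k1 k2 hz h8
  simp only [nsmul_eq_mul, mul_one, Nat.cast_pow] at hsum2
  rw [abs_le]
  constructor <;> nlinarith

/-- Kloosterman sum. -/
noncomputable def kl {k : Type} [Field k] [Fintype k] (ψ : AddChar k ℂ) (b : k) : ℂ :=
  open Classical in ∑ x : k, if x = 0 then 0 else ψ (x + b / x)

lemma card_quad {k : Type} [Field k] [Fintype k] [DecidableEq k] (hch : ringChar k ≠ 2) (u b : k) :
    (((Finset.univ.filter fun x : k => x ^ 2 - u * x + b = 0).card : ℕ) : ℤ)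
      = 1 + quadraticChar k (u ^ 2 - 4 * b) := by
  have h2 : (2 : k) ≠ 0 := Ring.two_ne_zero hch
  rw [add_comm, ← quadraticChar_card_sqrts hch]
  congr 1
  apply Finset.card_bij (fun x _ => 2 * x - u)
  · intro x hx
    simp only [Finset.mem_filter, Finset.mem_univ, true_and] at hx
    simp only [Set.mem_toFinset, Set.mem_ofPred_eq]
    linear_combination 4 * hx
  · intro x _ y _ h
    have : 2 * (x - y) = 0 := by linear_combination h
    rcases mul_eq_zero.1 this with h | h
    · exact absurd h h2
    · exact sub_eq_zero.1 h
  · intro z hz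
    simp only [Set.mem_toFinset, Set.mem_ofPred_eq] at hz
    refine ⟨(z + u) / 2, ?_, by field_simp; ring⟩
    simp only [Finset.mem_filter, Finset.mem_univ, true_and]
    field_simp
    linear_combination hz

lemma kl_eq {k : Type} [Field k] [Fintype k] [DecidableEq k] (hch : ringChar k ≠ 2)
    (ψ : AddChar k ℂ) (hψ : ψ ≠ 1) (b : k) (hb : b ≠ 0) :
    kl ψ b = ∑ u : k, ψ u * ((quadraticChar k (u ^ 2 - 4 * b) : ℤ) : ℂ) := by
  have h1 : kl ψ b = ∑ x : k, ∑ u : k, if x ^ 2 - u * x + b = 0 then ψ u else 0 := by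
    unfold kl
    refine Finset.sum_congr rfl fun x _ => ?_
    split_ifs with hx
    · subst hx
      simp [hb]
    · rw [Finset.sum_eq_single (x + b / x)]
      · rw [if_pos]; field_simp; ring
      · intro u _ hu
        rw [if_neg]
        intro h
        apply hu
        field_simp
        linear_combination -h
      · simp
  rw [h1, Finset.sum_comm]
  have h3 : ∀ u : k, (∑ x : k, if x ^ 2 - u * x + b = 0 then ψ u else 0)
      = ψ u + ψ u * ((quadraticChar k (u ^ 2 - 4 * b) : ℤ) : ℂ) := by
    intro u
    rw [← Finset.sum_filter, Finset.sum_const, nsmul_eq_mul]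
    have := congrArg (fun z : ℤ => (z : ℂ)) (card_quad hch u b)
    simp only [Int.cast_natCast, Int.cast_add, Int.cast_one] at this
    rw [this]; ring
  rw [Finset.sum_congr rfl fun u _ => h3 u, Finset.sum_add_distrib,
    AddChar.sum_eq_zero_of_ne_one hψ, zero_add]

lemma kl_bound {k : Type} [Field k] [Fintype k]
    (p e r q : ℕ) [Fact p.Prime] [CharP k p] (hr : r = p ^ e) (hodd : Odd r)
    (hcard : Fintype.card k = r ^ 2) (hq : 2 ≤ q) (hpq : p ∣ q) (hbig : 4 * q + 1 ≤ r)
    (ψ : AddChar k ℂ) (hψ : ψ ≠ 1) (b : k) (hb : b ≠ 0) (hinv : ∀ y, ψ (y ^ q) = ψ y) :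
    ‖kl ψ b‖ ≤ r * (10 * q + 4) := by
  classical
  have hch : ringChar k ≠ 2 := ringChar_ne_two_of_odd (by rw [hcard]; exact hodd.pow)
  have h2 : (2 : k) ≠ 0 := Ring.two_ne_zero hch
  have hq0 : (q : k) = 0 := (CharP.cast_eq_zero_iff k p q).2 hpq
  let D : k → k[X] := fun γ => (X ^ q - X + C γ) ^ 2 - C (4 * b)
  have hU : ∀ γ : k, (X ^ q - X + C γ : k[X]).natDegree = q := by
    intro γ
    have h1 : (X : k[X]).natDegree < (X ^ q : k[X]).natDegree := by simp; omega
    rw [natDegree_add_C, natDegree_sub_eq_left_of_natDegree_lt h1, natDegree_X_pow]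
  have hdeg : ∀ γ, (D γ).natDegree = 2 * q := by
    intro γ
    simp only [D]
    rw [natDegree_sub_C, natDegree_pow, hU]
  have hsqf : ∀ γ, Squarefree (D γ) := by
    intro γ
    apply Separable.squarefree
    rw [separable_def']
    have hder : derivative (D γ) = - C 2 * (X ^ q - X + C γ) := by
      simp only [D, derivative_sub, derivative_pow, derivative_add, derivative_X, derivative_C, hq0, C_0]
      simp
    refine ⟨C (-(4 * b)⁻¹), C (-(4 * b)⁻¹ * 2⁻¹) * (X ^ q - X + C γ), ?_⟩
    rw [hder]
    simp only [D]
    have e1 : (C (-(4 * b)⁻¹) : k[X]) * C (4 * b) = -1 := by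
      rw [← C_mul, neg_mul, inv_mul_cancel₀, C_neg, C_1]
      rw [show (4 : k) = 2 * 2 by norm_num]
      exact mul_ne_zero (mul_ne_zero h2 h2) hb
    have e2 : (C (2⁻¹) : k[X]) * C 2 = 1 := by
      rw [← C_mul, inv_mul_cancel₀ h2, C_1]
    rw [C_mul (a := -(4 * b)⁻¹) (b := 2⁻¹)]
    linear_combination (-1 : k[X]) * e1 - C (-(4 * b)⁻¹) * (X ^ q - X + C γ) ^ 2 * e2
  have hmain : ∀ γ, ‖∑ y : k, (((quadraticChar k ((D γ).eval y) : ℤ)) : ℂ)‖ ≤ r * (10 * q + 4) := by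
    intro γ
    have := quad_sum_bound p e r hr hodd hcard (D γ) (hsqf γ) (by
      intro hu
      have := natDegree_eq_zero_of_isUnit hu
      rw [hdeg] at this; omega) (by rw [hdeg]; omega)
    rw [hdeg] at this
    rw [← Int.cast_sum, Complex.norm_intCast]
    have h := (Int.cast_le (R := ℝ)).2 this
    push_cast at h ⊢
    linarith
  have havg : (Fintype.card k : ℂ) * kl ψ b =
      ∑ γ : k, ψ γ * ∑ y : k, (((quadraticChar k ((D γ).eval y) : ℤ)) : ℂ) := by
    rw [kl_eq hch ψ hψ b hb]
    simp only [Finset.mul_sum]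
    rw [Finset.sum_comm (s := (Finset.univ : Finset k)) (t := (Finset.univ : Finset k))
      (f := fun γ y => ψ γ * (((quadraticChar k ((D γ).eval y) : ℤ)) : ℂ))]
    have : ∀ y : k, ∑ γ : k, ψ γ * (((quadraticChar k ((D γ).eval y) : ℤ)) : ℂ)
        = ∑ u : k, ψ u * ((quadraticChar k (u ^ 2 - 4 * b) : ℤ) : ℂ) := by
      intro y
      apply Fintype.sum_equiv (Equiv.addLeft (y ^ q - y))
      intro γ
      simp only [Equiv.coe_addLeft, D, eval_sub, eval_pow, eval_add, eval_X, eval_C]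
      rw [AddChar.map_add_eq_mul, AddChar.map_sub_eq_div, hinv, div_self (fun h0 => by have := AddChar.norm_apply ψ y; rw [h0] at this; simp at this), one_mul]
    rw [Finset.sum_congr rfl fun y _ => this y, Finset.sum_const, nsmul_eq_mul, Finset.card_univ,
      Finset.mul_sum]
  have hQ : (0 : ℝ) < Fintype.card k := by exact_mod_cast Fintype.card_pos
  have : (Fintype.card k : ℝ) * ‖kl ψ b‖ ≤ (Fintype.card k : ℝ) * (r * (10 * q + 4)) := by
    calc (Fintype.card k : ℝ) * ‖kl ψ b‖ = ‖(Fintype.card k : ℂ) * kl ψ b‖ := by simp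
      _ ≤ ∑ γ : k, ‖ψ γ * ∑ y : k, (((quadraticChar k ((D γ).eval y) : ℤ)) : ℂ)‖ := by
        rw [havg]; exact norm_sum_le _ _
      _ ≤ ∑ γ : k, (r * (10 * q + 4) : ℝ) := by
        apply Finset.sum_le_sum
        intro γ _
        rw [norm_mul, AddChar.norm_apply, one_mul]
        exact hmain γ
      _ = _ := by simp
  exact le_of_mul_le_mul_left this hQ

lemma sum_sq_nonsq {F : Type} [Field F] [Fintype F] [DecidableEq F] (hch : ringChar F ≠ 2)
    (δ : F) (hδ : ¬ IsSquare δ) (G : F → ℂ) :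
    ∑ v : F, G (v ^ 2) + ∑ v : F, G (δ * v ^ 2) = 2 * ∑ w : F, G w := by
  have hδ0 : δ ≠ 0 := by rintro rfl; exact hδ ⟨0, by simp⟩
  have h1 : ∀ g : F → F, ∑ v : F, G (g v) = ∑ w : F,
      (((Finset.univ.filter fun v : F => g v = w).card : ℕ) : ℂ) * G w := by
    intro g
    have : ∀ v : F, G (g v) = ∑ w : F, if g v = w then G w else 0 := by
      intro v; simp
    rw [Finset.sum_congr rfl fun v _ => this v, Finset.sum_comm]
    refine Finset.sum_congr rfl fun w _ => ?_
    rw [← Finset.sum_filter, Finset.sum_const, nsmul_eq_mul]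
  rw [h1 (fun v => v ^ 2), h1 (fun v => δ * v ^ 2), ← Finset.sum_add_distrib, Finset.mul_sum]
  refine Finset.sum_congr rfl fun w _ => ?_
  rw [← add_mul]
  congr 1
  have c1 : (((Finset.univ.filter fun v : F => v ^ 2 = w).card : ℕ) : ℤ) = quadraticChar F w + 1 := by
    rw [← quadraticChar_card_sqrts hch]; congr 2; ext; simp
  have c2 : (((Finset.univ.filter fun v : F => δ * v ^ 2 = w).card : ℕ) : ℤ) = - quadraticChar F w + 1 := by
    have : - quadraticChar F w = quadraticChar F (w / δ) := by
      have h := map_mul (quadraticChar F) (w / δ) δ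
      rw [div_mul_cancel₀ _ hδ0, quadraticChar_neg_one_iff_not_isSquare.2 hδ] at h
      rw [h]; ring
    rw [this, ← quadraticChar_card_sqrts hch]; congr 2; ext v
    simp only [Finset.mem_filter, Finset.mem_univ, true_and, Set.mem_toFinset, Set.mem_ofPred_eq]
    rw [eq_div_iff hδ0, mul_comm]
  have : (((Finset.univ.filter fun v : F => v ^ 2 = w).card : ℕ) : ℤ) +
    (((Finset.univ.filter fun v : F => δ * v ^ 2 = w).card : ℕ) : ℤ) = 2 := by rw [c1, c2]; ring
  exact_mod_cast this

lemma sum_psi_mul {F : Type} [Field F] [Fintype F] [DecidableEq F] (ψ : AddChar F ℂ) (hψ : ψ ≠ 1) (a : F) :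
    ∑ x : F, ψ (x * a) = if a = 0 then (Fintype.card F : ℂ) else 0 := by
  rw [AddChar.sum_mulShift a (AddChar.IsPrimitive.of_ne_one hψ)]
  split_ifs <;> simp

/-- auxiliary summand -/
noncomputable def gg {F : Type} [Field F] (ψ : AddChar F ℂ) (b u w : F) : ℂ :=
  open Classical in if u ^ 2 - w = 0 then 0 else ψ (2 * u + b * (2 * u) / (u ^ 2 - w))

lemma gg_sum {F : Type} [Field F] [Fintype F] (hch : ringChar F ≠ 2)
    (ψ : AddChar F ℂ) (hψ : ψ ≠ 1) (b : F) (hb : b ≠ 0) :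
    ∑ u : F, ∑ w : F, gg ψ b u w = Fintype.card F := by
  classical
  have h2 : (2 : F) ≠ 0 := Ring.two_ne_zero hch
  have h1 : ∀ u : F, ∑ w : F, gg ψ b u w
      = ∑ N : F, if N = 0 then 0 else ψ (u * (2 * (1 + b / N))) := by
    intro u
    apply Fintype.sum_equiv (Equiv.subLeft (u ^ 2))
    intro w
    simp only [gg, Equiv.subLeft_apply]
    split_ifs with h
    · rfl
    · congr 1; field_simp
  rw [Finset.sum_congr rfl fun u _ => h1 u, Finset.sum_comm, Finset.sum_eq_single (-b)]
  · simp [hb]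
  · intro N _ hN
    split_ifs with h
    · simp
    · rw [sum_psi_mul ψ hψ, if_neg]
      apply mul_ne_zero h2
      intro h0
      apply hN
      field_simp at h0
      linear_combination h0
  · simp

lemma kl_sq {F : Type} [Field F] [Fintype F] (hch : ringChar F ≠ 2)
    (ψ : AddChar F ℂ) (b : F) :
    kl ψ b ^ 2 = ∑ u : F, ∑ v : F, gg ψ b u (v ^ 2) := by
  classical
  have h2 : (2 : F) ≠ 0 := Ring.two_ne_zero hch
  unfold kl
  rw [sq, Finset.sum_mul_sum, ← Fintype.sum_prod_type', ← Fintype.sum_prod_type']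
  symm
  let e : F × F ≃ F × F :=
    { toFun := fun z => (z.1 + z.2, z.1 - z.2)
      invFun := fun z => ((z.1 + z.2) / 2, (z.1 - z.2) / 2)
      left_inv := fun z => by ext <;> simp <;> field_simp <;> ring
      right_inv := fun z => by ext <;> simp <;> field_simp <;> ring }
  apply Fintype.sum_equiv e
  rintro ⟨u, v⟩
  simp only [e, Equiv.coe_fn_mk, gg]
  have hf : u ^ 2 - v ^ 2 = (u + v) * (u - v) := by ring
  by_cases h3 : u + v = 0
  · simp [hf, h3]
  by_cases h4 : u - v = 0
  · simp [hf, h4]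
  rw [if_neg (by rw [hf]; exact mul_ne_zero h3 h4), if_neg h3, if_neg h4, ← AddChar.map_add_eq_mul, hf]
  congr 1
  field_simp
  ring

lemma qa_re {F : Type} [Field F] (δ : F) [Fact (∀ r : F, r ^ 2 ≠ δ + 0 * r)] (b : F)
    (z : QuadraticAlgebra F δ 0) :
    (z + algebraMap F (QuadraticAlgebra F δ 0) b / z).re = z.re + b * z.re / z.norm := by
  rw [div_eq_mul_inv, QuadraticAlgebra.inv_def]
  simp [QuadraticAlgebra.algebraMap_re]
  ring

lemma kl_ext {F : Type} [Field F] [Fintype F] (p a q : ℕ) [Fact p.Prime] [CharP F p] (hq : q = p ^ a)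
    (hch : ringChar F ≠ 2)
    (ψ : AddChar F ℂ) (hψ : ψ ≠ 1) (b : F) (hb : b ≠ 0) (hinv : ∀ y, ψ (y ^ q) = ψ y) :
    ∃ (L : Type) (_ : Field L) (_ : Fintype L) (_ : CharP L p) (ψ' : AddChar L ℂ) (b' : L),
      Fintype.card L = Fintype.card F ^ 2 ∧ ψ' ≠ 1 ∧ b' ≠ 0 ∧ (∀ y, ψ' (y ^ q) = ψ' y) ∧
      kl ψ' b' = 2 * Fintype.card F - kl ψ b ^ 2 := by
  classical
  obtain ⟨δ, hδ⟩ := FiniteField.exists_nonsquare hch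
  have h2 : (2 : F) ≠ 0 := Ring.two_ne_zero hch
  have : Fact (∀ r : F, r ^ 2 ≠ δ + 0 * r) := ⟨fun r h => hδ ⟨r, by rw [← sq, h]; ring⟩⟩
  let L := QuadraticAlgebra F δ 0
  let : Fintype L := Fintype.ofEquiv (F × F) (QuadraticAlgebra.equivProd δ 0).symm
  have hcp : CharP L p := charP_of_injective_algebraMap (algebraMap F L).injective p
  let tr : L →+ F := (QuadraticAlgebra.trace : L →ₗ[F] F).toAddMonoidHom
  have htr : ∀ z : L, tr z = 2 * z.re := by
    intro z
    change QuadraticAlgebra.trace z = _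
    rw [QuadraticAlgebra.trace_def]; ring
  refine ⟨L, inferInstance, inferInstance, hcp, ψ.compAddMonoidHom tr, algebraMap F L b, ?_, ?_, ?_, ?_, ?_⟩
  · rw [Fintype.card_congr (QuadraticAlgebra.equivProd δ 0), Fintype.card_prod, sq]
  · intro h
    apply hψ
    ext x
    have := DFunLike.congr_fun h (algebraMap F L (x / 2))
    rw [AddChar.compAddMonoidHom_apply, htr, QuadraticAlgebra.algebraMap_re] at this
    rw [mul_div_cancel₀ _ h2] at this
    simpa using this
  · simpa using hb
  · intro y
    rw [AddChar.compAddMonoidHom_apply, AddChar.compAddMonoidHom_apply]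
    have : tr (y ^ q) = tr y ^ q := by
      apply (algebraMap F L).injective
      rw [map_pow (algebraMap F L)]
      have h := fun z : L => QuadraticAlgebra.algebraMap_trace_eq_add_star (z := z)
      change algebraMap F L (QuadraticAlgebra.trace (y ^ q)) = algebraMap F L (QuadraticAlgebra.trace y) ^ q
      rw [h, h, star_pow, hq, add_pow_char_pow]
    rw [this, hinv]
  · have key : kl (ψ.compAddMonoidHom tr) (algebraMap F L b) = ∑ u : F, ∑ v : F, gg ψ b u (δ * v ^ 2) := by
      unfold kl
      rw [← Fintype.sum_prod_type']
      apply Fintype.sum_equiv (QuadraticAlgebra.equivProd δ 0)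
      intro z
      have hn : z.norm = z.re ^ 2 - δ * z.im ^ 2 := by
        rw [QuadraticAlgebra.norm_def]; ring
      have he : QuadraticAlgebra.equivProd δ 0 z = (z.re, z.im) := rfl
      simp only [gg, he]
      rw [← hn]
      by_cases hz : z = 0
      · subst hz; simp
      · rw [if_neg hz, if_neg (fun h => hz (QuadraticAlgebra.norm_eq_zero_iff_eq_zero.1 h))]
        rw [AddChar.compAddMonoidHom_apply, htr]
        congr 1
        rw [qa_re]
        ring
    rw [key, kl_sq hch, eq_sub_iff_add_eq, ← gg_sum hch ψ hψ b hb, Finset.mul_sum, ← Finset.sum_add_distrib]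
    refine Finset.sum_congr rfl fun u _ => ?_
    rw [add_comm]
    exact sum_sq_nonsq hch δ hδ (gg ψ b u)

/-- Kloosterman data -/
def Klo (p q Q : ℕ) (c : ℝ) : Prop :=
  ∃ (k : Type) (_ : Field k) (_ : Fintype k) (_ : CharP k p) (ψ : AddChar k ℂ) (b : k),
    Fintype.card k = Q ∧ ψ ≠ 1 ∧ b ≠ 0 ∧ (∀ y, ψ (y ^ q) = ψ y) ∧ ‖kl ψ b‖ = c

lemma Klo_step (p a q Q : ℕ) [Fact p.Prime] (hq : q = p ^ a) (hQ : Odd Q) (c : ℝ) (h : Klo p q Q c) :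
    ∃ c', Klo p q (Q ^ 2) c' ∧ c ^ 2 - 2 * Q ≤ c' := by
  obtain ⟨k, _, _, _, ψ, b, h1, h2, h3, h4, h5⟩ := h
  obtain ⟨L, i1, i2, i3, ψ', b', g1, g2, g3, g4, g5⟩ :=
    kl_ext p a q hq (ringChar_ne_two_of_odd (by rwa [h1])) ψ h2 b h3 h4
  refine ⟨_, ⟨L, i1, i2, i3, ψ', b', by rw [g1, h1], g2, g3, g4, rfl⟩, ?_⟩
  rw [g5, h1, norm_sub_rev]
  refine le_trans ?_ (norm_sub_norm_le _ _)
  rw [norm_pow, h5]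
  simp

lemma Klo_iter (p a q : ℕ) [Fact p.Prime] (hq : q = p ^ a) (hodd : Odd q) (ε : ℝ) (hε : 0 ≤ ε)
    (h : Klo p q (q ^ 2) ((q : ℝ) * (2 + ε))) (j : ℕ) :
    ∃ c, Klo p q ((q ^ (2 ^ j)) ^ 2) c ∧ ((q ^ (2 ^ j) : ℕ) : ℝ) * (2 + 4 ^ j * ε) ≤ c := by
  induction j with
  | zero => exact ⟨_, by simpa using h, by simp⟩
  | succ j ih =>
    obtain ⟨c, hc, hle⟩ := ih
    obtain ⟨c', hc', hle'⟩ := Klo_step p a q _ hq ((hodd.pow).pow) c hc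
    refine ⟨c', by rw [pow_succ 2 j, pow_mul q]; exact hc', ?_⟩
    refine le_trans ?_ hle'
    rw [pow_succ 2 j, pow_mul q]
    set r : ℕ := q ^ 2 ^ j
    have hr : (0 : ℝ) ≤ r := Nat.cast_nonneg _
    have h4 : (0 : ℝ) ≤ 4 ^ j * ε := by positivity
    have : ((r : ℝ) * (2 + 4 ^ j * ε)) ^ 2 ≤ c ^ 2 := pow_le_pow_left₀ (by positivity) hle 2
    push_cast
    rw [pow_succ (4 : ℝ) j]
    nlinarith [mul_nonneg (sq_nonneg (r : ℝ)) (sq_nonneg ((4 : ℝ) ^ j * ε))]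

lemma Klo_mono_contra (p a q : ℕ) [Fact p.Prime] (hq : q = p ^ a) (ha : a ≠ 0) (hodd : Odd q) (ε : ℝ)
    (h : Klo p q (q ^ 2) ((q : ℝ) * (2 + ε))) : ε ≤ 0 := by
  by_contra hε
  push Not at hε
  have hq3 : 2 ≤ q := by
    rw [hq]; exact (Fact.out : p.Prime).two_le.trans (Nat.le_self_pow ha p)
  have hpq : p ∣ q := by rw [hq]; exact dvd_pow_self p ha
  obtain ⟨J, hJ⟩ := pow_unbounded_of_one_lt ((10 * q + 4) / ε) (by norm_num : (1 : ℝ) < 4)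
  let j := max J (4 * q + 1)
  have hj : (10 * q + 4) / ε < (4 : ℝ) ^ j :=
    hJ.trans_le (pow_le_pow_right₀ (by norm_num) (le_max_left _ _))
  obtain ⟨c, hc, hle⟩ := Klo_iter p a q hq hodd ε hε.le h j
  obtain ⟨k, _, _, _, ψ, b, h1, h2, h3, h4, h5⟩ := hc
  have hbig : 4 * q + 1 ≤ q ^ 2 ^ j := by
    have h1 : 4 * q + 1 ≤ j := le_max_right _ _
    have h2 : j < 2 ^ j := Nat.lt_two_pow_self
    have h3 : 2 ^ j < 2 ^ (2 ^ j) := Nat.lt_two_pow_self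
    have h4 : 2 ^ (2 ^ j) ≤ q ^ (2 ^ j) := Nat.pow_le_pow_left hq3 _
    omega
  have hb := kl_bound p (a * 2 ^ j) (q ^ 2 ^ j) q (by rw [hq, pow_mul]) hodd.pow h1 hq3 hpq hbig ψ h2 b h3 h4
  rw [h5] at hb
  have hr : (0 : ℝ) < ((q ^ 2 ^ j : ℕ) : ℝ) := by exact_mod_cast (by omega)
  have h6 := le_of_mul_le_mul_left (hle.trans hb) hr
  rw [div_lt_iff₀ hε] at hj
  linarith

theorem weil_kloosterman {F : Type} [Field F] [Fintype F] (hodd : Odd (Fintype.card F))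
    (ψ : AddChar F ℂ) (hψ : ψ ≠ 1) (b : F) (hb : b ≠ 0) :
    ‖kl ψ b‖ ^ 2 ≤ 4 * Fintype.card F := by
  obtain ⟨p, hp⟩ := CharP.exists F
  obtain ⟨a, hpp, hcard⟩ := FiniteField.card F p
  have : Fact p.Prime := ⟨hpp⟩
  obtain ⟨c, hc, hle⟩ := Klo_step p a (Fintype.card F) (Fintype.card F) hcard hodd _
    ⟨F, inferInstance, inferInstance, hp, ψ, b, rfl, hψ, hb, fun y => by rw [FiniteField.pow_card], rfl⟩
  have hq : (0 : ℝ) < Fintype.card F := by exact_mod_cast Fintype.card_pos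
  have := Klo_mono_contra p a (Fintype.card F) hcard a.pos.ne' hodd (c / Fintype.card F - 2)
    (by convert hc using 1; field_simp; ring)
  have h2 : c ≤ 2 * Fintype.card F := by
    rw [sub_nonpos, div_le_iff₀ hq] at this
    exact this
  linarith

/-- quadratic Gauss sum -/
noncomputable def gs {F : Type} [Field F] [Fintype F] [DecidableEq F] (ψ : AddChar F ℂ) : ℂ :=
  ∑ w : F, ((quadraticChar F w : ℤ) : ℂ) * ψ w

lemma gs_norm {F : Type} [Field F] [Fintype F] [DecidableEq F] (hch : ringChar F ≠ 2)
    (ψ : AddChar F ℂ) (hψ : ψ ≠ 1) : ‖gs ψ‖ ^ 2 = Fintype.card F := by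
  let χ : MulChar F ℂ := (quadraticChar F).ringHomComp (Int.castRingHom ℂ)
  have hq : χ.IsQuadratic := (quadraticChar_isQuadratic F).comp _
  have h1 : χ ≠ 1 := by
    obtain ⟨a, ha⟩ := quadraticChar_exists_neg_one' hch
    intro h
    have h2 : χ a = 1 := by rw [h, MulChar.one_apply_coe]
    simp only [χ, MulChar.ringHomComp_apply, ha] at h2
    norm_num at h2
  have h2 := gaussSum_sq h1 hq (AddChar.IsPrimitive.of_ne_one hψ)
  have h3 : gaussSum χ ψ = gs ψ := by
    simp [gaussSum, gs, χ, MulChar.ringHomComp_apply]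
  rw [h3] at h2
  rw [← norm_pow, h2, norm_mul]
  have : ‖χ (-1)‖ = 1 := by
    simp only [χ, MulChar.ringHomComp_apply]
    rcases quadraticChar_dichotomy (F := F) (a := -1) (neg_ne_zero.2 one_ne_zero) with h | h <;> simp [h]
  rw [this]; simp

lemma eta_sq {F : Type} [Field F] [Fintype F] [DecidableEq F] {s : F} (hs : s ≠ 0) :
    ((quadraticChar F s : ℤ) : ℂ) * ((quadraticChar F s : ℤ) : ℂ) = 1 := by
  rcases quadraticChar_dichotomy hs with h | h <;> simp [h]

lemma eta_norm {F : Type} [Field F] [Fintype F] [DecidableEq F] {s : F} (hs : s ≠ 0) :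
    ‖((quadraticChar F s : ℤ) : ℂ)‖ = 1 := by
  rcases quadraticChar_dichotomy hs with h | h <;> simp [h]

lemma gauss_quad0 {F : Type} [Field F] [Fintype F] [DecidableEq F] (hch : ringChar F ≠ 2)
    (ψ : AddChar F ℂ) (hψ : ψ ≠ 1) (s : F) (hs : s ≠ 0) :
    ∑ z : F, ψ (s * z ^ 2) = ((quadraticChar F s : ℤ) : ℂ) * gs ψ := by
  have h1 : ∀ v : F, ψ (s * v ^ 2) = ∑ w : F, if v ^ 2 = w then ψ (s * w) else 0 := by
    intro v; simp
  rw [Finset.sum_congr rfl fun v _ => h1 v, Finset.sum_comm]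
  have h2 : ∀ w : F, (∑ v : F, if v ^ 2 = w then ψ (s * w) else 0)
      = ψ (w * s) + ((quadraticChar F w : ℤ) : ℂ) * ψ (s * w) := by
    intro w
    rw [← Finset.sum_filter, Finset.sum_const, nsmul_eq_mul]
    have c1 : (((Finset.univ.filter fun v : F => v ^ 2 = w).card : ℕ) : ℤ) = quadraticChar F w + 1 := by
      rw [← quadraticChar_card_sqrts hch]; congr 2; ext; simp
    have := congrArg (fun z : ℤ => (z : ℂ)) c1
    simp only [Int.cast_natCast, Int.cast_add, Int.cast_one] at this
    rw [this, mul_comm w s]; ring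
  rw [Finset.sum_congr rfl fun w _ => h2 w, Finset.sum_add_distrib, sum_psi_mul ψ hψ, if_neg hs, zero_add,
    gs, Finset.mul_sum]
  apply Fintype.sum_equiv (Equiv.mulLeft₀ s hs)
  intro w
  simp only [Equiv.mulLeft₀_apply, map_mul, Int.cast_mul]
  rw [← mul_assoc, ← mul_assoc, eta_sq hs, one_mul]

lemma gauss_quad {F : Type} [Field F] [Fintype F] [DecidableEq F] (hch : ringChar F ≠ 2)
    (ψ : AddChar F ℂ) (hψ : ψ ≠ 1) (s m : F) (hs : s ≠ 0) :
    ∑ z : F, ψ (s * z ^ 2 + m * z) = ψ (-(m ^ 2 / (4 * s))) * (((quadraticChar F s : ℤ) : ℂ) * gs ψ) := by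
  have h2 : (2 : F) ≠ 0 := Ring.two_ne_zero hch
  have h4 : (4 : F) ≠ 0 := by rw [show (4 : F) = 2 * 2 by norm_num]; exact mul_ne_zero h2 h2
  rw [← gauss_quad0 hch ψ hψ s hs, Finset.mul_sum]
  apply Fintype.sum_equiv (Equiv.addRight (m / (2 * s)))
  intro z
  rw [← AddChar.map_add_eq_mul]
  congr 1
  simp only [Equiv.coe_addRight]
  field_simp
  ring

/-- Salié sum -/
noncomputable def sal {F : Type} [Field F] [Fintype F] [DecidableEq F] (ψ : AddChar F ℂ) (c : F) : ℂ :=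
  ∑ s : F, ((quadraticChar F s : ℤ) : ℂ) * ψ (s + c / s)

lemma sal_bound {F : Type} [Field F] [Fintype F] [DecidableEq F] (hch : ringChar F ≠ 2)
    (ψ : AddChar F ℂ) (hψ : ψ ≠ 1) (c : F) : ‖sal ψ c‖ ^ 2 ≤ 4 * Fintype.card F := by
  have h2 : (2 : F) ≠ 0 := Ring.two_ne_zero hch
  have hq : (0 : ℝ) < Fintype.card F := by exact_mod_cast Fintype.card_pos
  have hG := gs_norm hch ψ hψ
  rcases eq_or_ne c 0 with hc | hc
  · have : sal ψ c = gs ψ := by simp [sal, gs, hc]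
    rw [this, hG]; linarith
  by_cases hsq : IsSquare c
  · obtain ⟨e, he⟩ := hsq
    have he0 : e ≠ 0 := by rintro rfl; simp at he; exact hc he
    have key : ((quadraticChar F (-1) : ℤ) : ℂ) * gs ψ * sal ψ c
        = ∑ z : F, ψ (2 * e * z) * (if z ^ 2 = 1 then (Fintype.card F : ℂ) else 0) := by
      have a1 : ((quadraticChar F (-1) : ℤ) : ℂ) * gs ψ * sal ψ c
          = ∑ s : F, ∑ z : F, if s = 0 then 0 else ψ (s - s * z ^ 2 + 2 * e * z) := by
        rw [sal, Finset.mul_sum]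
        refine Finset.sum_congr rfl fun s _ => ?_
        split_ifs with hs
        · simp [hs]
        · have := gauss_quad hch ψ hψ (-s) (2 * e) (neg_ne_zero.2 hs)
          have e1 : ∀ z : F, ψ (s - s * z ^ 2 + 2 * e * z) = ψ s * ψ (-s * z ^ 2 + 2 * e * z) := by
            intro z; rw [← AddChar.map_add_eq_mul]; congr 1; ring
          rw [Finset.sum_congr rfl fun z _ => e1 z, ← Finset.mul_sum, this, AddChar.map_add_eq_mul]
          have e2 : -((2 * e) ^ 2 / (4 * -s)) = c / s := by
            have h4 : (4 : F) ≠ 0 := by rw [show (4 : F) = 2 * 2 by norm_num]; exact mul_ne_zero h2 h2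
            rw [he]; field_simp; ring
          rw [e2, show -s = -1 * s by ring, map_mul]
          push_cast; ring
      rw [a1, Finset.sum_comm]
      have a2 : ∀ z : F, (∑ s : F, if s = 0 then 0 else ψ (s - s * z ^ 2 + 2 * e * z))
          = ψ (2 * e * z) * (if z ^ 2 = 1 then (Fintype.card F : ℂ) else 0) - ψ (z * (2 * e)) := by
        intro z
        have b1 : ∀ s : F, (if s = 0 then 0 else ψ (s - s * z ^ 2 + 2 * e * z))
            = ψ (2 * e * z) * ψ (s * (1 - z ^ 2)) - if s = 0 then ψ (z * (2 * e)) else 0 := by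
          intro s
          split_ifs with hs
          · simp [hs, mul_comm]
          · rw [← AddChar.map_add_eq_mul, sub_zero]; congr 1; ring
        rw [Finset.sum_congr rfl fun s _ => b1 s, Finset.sum_sub_distrib, ← Finset.mul_sum,
          sum_psi_mul ψ hψ]
        simp only [sub_eq_zero, eq_comm (a := (1 : F)), Finset.sum_ite_eq', Finset.mem_univ, if_true]
      rw [Finset.sum_congr rfl fun z _ => a2 z, Finset.sum_sub_distrib, sum_psi_mul ψ hψ,
        if_neg (mul_ne_zero h2 he0), sub_zero]
    have hle : ‖gs ψ‖ * ‖sal ψ c‖ ≤ 2 * Fintype.card F := by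
      calc ‖gs ψ‖ * ‖sal ψ c‖ = ‖((quadraticChar F (-1) : ℤ) : ℂ) * gs ψ * sal ψ c‖ := by
            rw [norm_mul, norm_mul, eta_norm (neg_ne_zero.2 one_ne_zero), one_mul]
        _ ≤ ∑ z : F, ‖ψ (2 * e * z) * (if z ^ 2 = 1 then (Fintype.card F : ℂ) else 0)‖ := by
            rw [key]; exact norm_sum_le _ _
        _ = ∑ z : F, (if z ^ 2 = 1 then (Fintype.card F : ℝ) else 0) := by
            refine Finset.sum_congr rfl fun z _ => ?_
            rw [norm_mul, AddChar.norm_apply, one_mul]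
            split_ifs <;> simp
        _ = ((Finset.univ.filter fun z : F => z ^ 2 = 1).card : ℝ) * Fintype.card F := by
            rw [← Finset.sum_filter, Finset.sum_const, nsmul_eq_mul]
        _ ≤ 2 * Fintype.card F := by
            apply mul_le_mul_of_nonneg_right _ hq.le
            have : (Finset.univ.filter fun z : F => z ^ 2 = 1) ⊆ {1, -1} := by
              intro z hz
              simp only [Finset.mem_filter, Finset.mem_univ, true_and] at hz
              rcases mul_eq_zero.1 (by linear_combination hz : (z - 1) * (z + 1) = 0) with h | h
              · simp [sub_eq_zero.1 h]
              · simp [eq_neg_of_add_eq_zero_left h]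
            exact_mod_cast (Finset.card_le_card this).trans Finset.card_le_two
    have h5 : (‖gs ψ‖ * ‖sal ψ c‖) ^ 2 ≤ (2 * Fintype.card F) ^ 2 :=
      pow_le_pow_left₀ (by positivity) hle 2
    rw [mul_pow, hG] at h5
    have : (Fintype.card F : ℝ) * ‖sal ψ c‖ ^ 2 ≤ Fintype.card F * (4 * Fintype.card F) := by
      rw [← sub_nonneg] at h5 ⊢; convert h5 using 1; ring
    exact le_of_mul_le_mul_left this hq
  · have : sal ψ c = - sal ψ c := by
      conv_lhs => unfold sal
      rw [sal, ← Finset.sum_neg_distrib]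
      have hinv : ∀ s : F, c / (c / s) = s := by
        intro s; by_cases hs : s = 0
        · simp [hs]
        · field_simp
      apply Fintype.sum_equiv (⟨fun s => c / s, fun s => c / s, hinv, hinv⟩ : F ≃ F)
      intro s
      simp only [Equiv.coe_fn_mk, hinv]
      by_cases hs : s = 0
      · simp [hs]
      · have h := map_mul (quadraticChar F) (c / s) s
        rw [div_mul_cancel₀ _ hs, quadraticChar_neg_one_iff_not_isSquare.2 hsq] at h
        have h' := congrArg (fun z : ℤ => (z : ℂ)) h
        simp only [Int.cast_mul, Int.cast_neg, Int.cast_one] at h'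
        have h6 := eta_sq (F := F) hs
        rw [add_comm (c / s)]
        linear_combination (-(ψ (s + c / s)) * ((quadraticChar F s : ℤ) : ℂ)) * h' - (ψ (s + c / s)) * ((quadraticChar F (c / s) : ℤ) : ℂ) * h6
    have h0 : sal ψ c = 0 := by
      have : (2 : ℂ) * sal ψ c = 0 := by linear_combination this
      simpa using this
    rw [h0]; simp

lemma tw_bound {F : Type} [Field F] [Fintype F] [DecidableEq F] (hodd : Odd (Fintype.card F))
    (ψ : AddChar F ℂ) (hψ : ψ ≠ 1) (c : F) (d : ℕ) :
    ‖∑ s : F, if s = 0 then 0 else ((quadraticChar F s : ℤ) : ℂ) ^ d * ψ (s + c / s)‖ ^ 2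
      ≤ 4 * Fintype.card F := by
  have hch := ringChar_ne_two_of_odd hodd
  have hq : (1 : ℝ) ≤ Fintype.card F := by exact_mod_cast Fintype.card_pos
  rcases Nat.even_or_odd' d with ⟨t, ht | ht⟩
  · have h1 : (∑ s : F, if s = 0 then 0 else ((quadraticChar F s : ℤ) : ℂ) ^ d * ψ (s + c / s)) = kl ψ c := by
      unfold kl
      refine Finset.sum_congr rfl fun s _ => ?_
      split_ifs with hs
      · rfl
      · rw [ht, pow_mul, sq, eta_sq hs, one_pow, one_mul]
    rw [h1]
    rcases eq_or_ne c 0 with hc | hc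
    · have : kl ψ c = -1 := by
        have h0 := AddChar.sum_eq_zero_of_ne_one hψ
        unfold kl
        have h3 : ∀ s : F, (if s = 0 then 0 else ψ (s + c / s)) = ψ s - if s = 0 then 1 else 0 := by
          intro s; split_ifs with hs <;> simp [hs, hc]
        rw [Finset.sum_congr rfl fun s _ => by convert h3 s, Finset.sum_sub_distrib, h0]
        simp
      rw [this]; simp; linarith
    · exact weil_kloosterman hodd ψ hψ c hc
  · have h1 : (∑ s : F, if s = 0 then 0 else ((quadraticChar F s : ℤ) : ℂ) ^ d * ψ (s + c / s)) = sal ψ c := by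
      unfold sal
      refine Finset.sum_congr rfl fun s _ => ?_
      split_ifs with hs
      · simp [hs]
      · rw [ht, pow_succ, pow_mul, sq, eta_sq hs, one_pow, one_mul]
    rw [h1]
    exact sal_bound hch ψ hψ c

/-- weighted walks -/
noncomputable def WW {F : Type} [Field F] [Fintype F] [DecidableEq F] {d : ℕ}
    (E : Finset (Fin d → F)) : ℕ → (Fin d → F) → ℝ
  | 0, x => if x ∈ E then 1 else 0
  | n + 1, x => ∑ y, (if x ∈ E ∧ y ∈ E ∧ ∑ j, (x j - y j) ^ 2 = 1 then 1 else 0) * WW E n y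

lemma WW_supp {F : Type} [Field F] [Fintype F] [DecidableEq F] {d : ℕ}
    (E : Finset (Fin d → F)) (n : ℕ) (x : Fin d → F) (hx : x ∉ E) : WW E n x = 0 := by
  cases n <;> simp [WW, hx]

lemma WW_comm {F : Type} [Field F] [Fintype F] [DecidableEq F] {d : ℕ}
    (E : Finset (Fin d → F)) (a b : ℕ) :
    ∑ x, WW E a x * WW E (b + 1) x = ∑ x, WW E (a + 1) x * WW E b x := by
  simp only [WW, Finset.mul_sum, Finset.sum_mul]
  rw [Finset.sum_comm]
  refine Finset.sum_congr rfl fun x _ => Finset.sum_congr rfl fun y _ => ?_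
  have : (y ∈ E ∧ x ∈ E ∧ ∑ j, (y j - x j) ^ 2 = 1) ↔ (x ∈ E ∧ y ∈ E ∧ ∑ j, (x j - y j) ^ 2 = 1) := by
    rw [Finset.sum_congr rfl fun j _ => (by ring : (y j - x j) ^ 2 = (x j - y j) ^ 2)]
    tauto
  simp only [this]
  ring

lemma WW_add {F : Type} [Field F] [Fintype F] [DecidableEq F] {d : ℕ}
    (E : Finset (Fin d → F)) (a b : ℕ) :
    ∑ x, WW E a x * WW E b x = ∑ x, WW E (a + b) x := by
  induction a generalizing b with
  | zero =>
    refine Finset.sum_congr rfl fun x _ => ?_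
    rw [zero_add]
    by_cases hx : x ∈ E
    · simp [WW, hx]
    · rw [WW_supp E b x hx, mul_zero]
  | succ a ih =>
    rw [← WW_comm, ih, show a + (b + 1) = a + 1 + b by ring]

lemma chain_cons {F : Type} [Field F] [Fintype F] [DecidableEq F] {d : ℕ}
    (E : Finset (Fin d → F)) (n : ℕ) (v : Fin d → F) :
    (∑ t : Fin n → (Fin d → F), if (∀ i, (Fin.cons v t : Fin (n + 1) → (Fin d → F)) i ∈ E) ∧
      ∀ i : Fin n, ∑ j, ((Fin.cons v t : Fin (n + 1) → (Fin d → F)) i.castSucc j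
        - (Fin.cons v t : Fin (n + 1) → (Fin d → F)) i.succ j) ^ 2 = 1 then (1 : ℝ) else 0) = WW E n v := by
  induction n generalizing v with
  | zero => simp [WW]
  | succ n ih =>
    rw [WW, ← (Fin.consEquiv (fun _ => Fin d → F)).sum_comp, Fintype.sum_prod_type]
    refine Finset.sum_congr rfl fun w _ => ?_
    rw [← ih w, Finset.mul_sum]
    refine Finset.sum_congr rfl fun t _ => ?_
    rw [ite_zero_mul, one_mul, ← ite_and]
    congr 1
    simp only [Fin.consEquiv_apply, Fin.forall_fin_succ (n := n + 1), Fin.forall_fin_succ (n := n),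
      Fin.cons_succ, Fin.cons_zero, Fin.castSucc_zero, ← Fin.succ_castSucc]
    apply propext
    tauto

lemma chainCount_eq {F : Type} [Field F] [Fintype F] [DecidableEq F] {d : ℕ}
    (E : Finset (Fin d → F)) (n : ℕ) : (chainCount E n : ℝ) = ∑ x, WW E n x := by
  rw [chainCount, ← Finset.sum_boole, ← (Fin.consEquiv (fun _ => Fin d → F)).sum_comp, Fintype.sum_prod_type]
  refine Finset.sum_congr rfl fun v _ => ?_
  rw [← chain_cons]
  rfl

lemma psi_sum_prod {F : Type} [Field F] {d : ℕ} (ψ : AddChar F ℂ) (g : Fin d → F) :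
    ψ (∑ j, g j) = ∏ j, ψ (g j) := by
  have h := map_prod ψ.toMonoidHom (fun j => Multiplicative.ofAdd (g j)) Finset.univ
  rw [← ofAdd_sum] at h
  exact h

lemma orth {F : Type} [Field F] [Fintype F] [DecidableEq F] (ψ : AddChar F ℂ) (hψ : ψ ≠ 1) {d : ℕ}
    (z : Fin d → F) : ∑ m : Fin d → F, ψ (∑ j, m j * z j)
      = if z = 0 then (Fintype.card F : ℂ) ^ d else 0 := by
  have h1 : ∑ m : Fin d → F, ψ (∑ j, m j * z j) = ∏ j : Fin d, ∑ a : F, ψ (a * z j) := by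
    rw [Finset.prod_univ_sum, Fintype.piFinset_univ]
    exact Finset.sum_congr rfl fun m _ => psi_sum_prod _ _
  rw [h1, Finset.prod_congr rfl fun j _ => sum_psi_mul ψ hψ (z j)]
  split_ifs with h
  · subst h; simp
  · obtain ⟨j, hj⟩ := Function.ne_iff.1 h
    exact Finset.prod_eq_zero (Finset.mem_univ j) (if_neg hj)

lemma fourier_bound {F : Type} [Field F] [Fintype F] [DecidableEq F] (ψ : AddChar F ℂ) (hψ : ψ ≠ 1) {d : ℕ}
    (κ : (Fin d → F) → ℂ) (M : ℝ) (hM : ∀ m : Fin d → F, ‖∑ z, κ z * ψ (∑ j, m j * z j)‖ ≤ M)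
    (f : (Fin d → F) → ℝ) :
    ‖∑ x, ∑ y, (f x : ℂ) * f y * κ (x - y)‖ ≤ M * ∑ x, f x * f x := by
  set Q : ℂ := (Fintype.card F : ℂ) ^ d with hQ
  let fh : (Fin d → F) → ℂ := fun m => ∑ x, (f x : ℂ) * ψ (∑ j, m j * x j)
  let kh : (Fin d → F) → ℂ := fun m => ∑ z, κ z * ψ (∑ j, m j * z j)
  have hconj : ∀ m, (starRingEnd ℂ) (fh m) = ∑ x, (f x : ℂ) * ψ (-∑ j, m j * x j) := by
    intro m
    simp only [fh, map_sum, map_mul, Complex.conj_ofReal, AddChar.map_neg_eq_conj]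
  have hinv : ∀ x y : Fin d → F, ∑ m, kh m * ψ (-∑ j, m j * x j) * ψ (∑ j, m j * y j) = Q * κ (x - y) := by
    intro x y
    simp only [kh, Finset.sum_mul]
    rw [Finset.sum_comm]
    have : ∀ z : Fin d → F, ∑ m : Fin d → F, κ z * ψ (∑ j, m j * z j) * ψ (-∑ j, m j * x j) * ψ (∑ j, m j * y j)
        = if z = x - y then Q * κ z else 0 := by
      intro z
      have e : ∀ m : Fin d → F, κ z * ψ (∑ j, m j * z j) * ψ (-∑ j, m j * x j) * ψ (∑ j, m j * y j)
          = κ z * ψ (∑ j, m j * (z - x + y) j) := by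
        intro m
        rw [mul_assoc, mul_assoc, ← AddChar.map_add_eq_mul, ← AddChar.map_add_eq_mul]
        congr 2
        rw [← Finset.sum_neg_distrib, ← Finset.sum_add_distrib, ← Finset.sum_add_distrib]
        refine Finset.sum_congr rfl fun j _ => ?_
        simp; ring
      rw [Finset.sum_congr rfl fun m _ => e m, ← Finset.mul_sum, orth ψ hψ]
      have : z - x + y = 0 ↔ z = x - y := by
        rw [sub_add, sub_eq_zero]
      simp only [this]
      split_ifs <;> ring
    rw [Finset.sum_congr rfl fun z _ => this z]
    simp
  have hpars : ∑ m, fh m * (starRingEnd ℂ) (fh m) = Q * ((∑ x, f x * f x : ℝ) : ℂ) := by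
    simp only [hconj]
    simp only [fh, Finset.sum_mul_sum]
    rw [Finset.sum_comm]
    push_cast
    rw [Finset.mul_sum]
    refine Finset.sum_congr rfl fun x _ => ?_
    rw [Finset.sum_comm, Finset.sum_eq_single x]
    · have : ∀ m : Fin d → F, (f x : ℂ) * ψ (∑ j, m j * x j) * ((f x : ℂ) * ψ (-∑ j, m j * x j)) = f x * f x := by
        intro m
        have : ψ (∑ j, m j * x j) * ψ (-∑ j, m j * x j) = 1 := by
          rw [← AddChar.map_add_eq_mul]; simp
        linear_combination (f x : ℂ) * f x * this
      rw [Finset.sum_congr rfl fun m _ => this m, Finset.sum_const, nsmul_eq_mul]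
      simp [hQ]
    · intro y _ hy
      have : ∀ m : Fin d → F, (f x : ℂ) * ψ (∑ j, m j * x j) * ((f y : ℂ) * ψ (-∑ j, m j * y j))
          = f x * f y * ψ (∑ j, m j * (x - y) j) := by
        intro m
        have : ψ (∑ j, m j * x j) * ψ (-∑ j, m j * y j) = ψ (∑ j, m j * (x - y) j) := by
          rw [← AddChar.map_add_eq_mul]; congr 1
          rw [← sub_eq_add_neg, ← Finset.sum_sub_distrib]
          refine Finset.sum_congr rfl fun j _ => ?_
          simp; ring
        linear_combination (f x : ℂ) * f y * this
      rw [Finset.sum_congr rfl fun m _ => this m, ← Finset.mul_sum, orth ψ hψ, if_neg, mul_zero]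
      rw [sub_eq_zero]; exact fun h => hy h.symm
    · simp
  have hmain : Q * ∑ x, ∑ y, (f x : ℂ) * f y * κ (x - y) = ∑ m, kh m * (fh m * (starRingEnd ℂ) (fh m)) := by
    simp only [hconj]
    have hR : ∀ m, kh m * (fh m * ∑ x, (f x : ℂ) * ψ (-∑ j, m j * x j)) = ∑ y, ∑ x, kh m *
        ((f y : ℂ) * ψ (∑ j, m j * y j) * ((f x : ℂ) * ψ (-∑ j, m j * x j))) := by
      intro m
      simp only [fh]
      rw [Finset.sum_mul_sum, Finset.mul_sum]
      exact Finset.sum_congr rfl fun y _ => Finset.mul_sum _ _ _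
    rw [Finset.sum_congr rfl fun m _ => hR m, Finset.sum_comm, Finset.mul_sum]
    refine Eq.trans ?_ Finset.sum_comm
    refine Finset.sum_congr rfl fun y _ => ?_
    rw [Finset.sum_comm, Finset.mul_sum]
    refine Finset.sum_congr rfl fun x _ => ?_
    have := hinv x y
    rw [show Q * ((f x : ℂ) * f y * κ (x - y)) = f x * f y * (Q * κ (x - y)) by ring, ← this, Finset.mul_sum]
    refine Finset.sum_congr rfl fun m _ => ?_
    ring
  have hQpos : (0 : ℝ) < ‖Q‖ := by
    rw [norm_pos_iff]
    exact pow_ne_zero _ (by exact_mod_cast Fintype.card_ne_zero)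
  have hQn : ‖Q‖ = (Fintype.card F : ℝ) ^ d := by simp [hQ]
  have hp2 : ∑ m, ‖fh m‖ ^ 2 = ‖Q‖ * ∑ x, f x * f x := by
    have h : ((∑ m, ‖fh m‖ ^ 2 : ℝ) : ℂ) = ((‖Q‖ * ∑ x, f x * f x : ℝ) : ℂ) := by
      rw [Complex.ofReal_mul, hQn]
      have h3 : (((Fintype.card F : ℝ) ^ d : ℝ) : ℂ) = Q := by simp [hQ]
      rw [h3, ← hpars, Complex.ofReal_sum]
      refine Finset.sum_congr rfl fun m _ => ?_
      rw [Complex.mul_conj, Complex.normSq_eq_norm_sq]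
    exact_mod_cast h
  have : ‖Q‖ * ‖∑ x, ∑ y, (f x : ℂ) * f y * κ (x - y)‖ ≤ ‖Q‖ * (M * ∑ x, f x * f x) := by
    rw [← norm_mul, hmain]
    calc _ ≤ ∑ m, ‖kh m * (fh m * (starRingEnd ℂ) (fh m))‖ := norm_sum_le _ _
      _ ≤ ∑ m, M * ‖fh m‖ ^ 2 := by
        refine Finset.sum_le_sum fun m _ => ?_
        rw [norm_mul, norm_mul, RCLike.norm_conj, ← sq]
        exact mul_le_mul_of_nonneg_right (hM m) (sq_nonneg _)
      _ = _ := by rw [← Finset.mul_sum, hp2]; ring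
  exact le_of_mul_le_mul_left this hQpos

/-- the kernel -/
noncomputable def kap {F : Type} [Field F] [Fintype F] [DecidableEq F] (ψ : AddChar F ℂ) {d : ℕ}
    (z : Fin d → F) : ℂ := ∑ s : F, if s = 0 then 0 else ψ (s * (∑ j, z j ^ 2 - 1))

lemma kap_eq {F : Type} [Field F] [Fintype F] [DecidableEq F] (ψ : AddChar F ℂ) (hψ : ψ ≠ 1) {d : ℕ}
    (z : Fin d → F) : 1 + kap ψ z = if ∑ j, z j ^ 2 = 1 then (Fintype.card F : ℂ) else 0 := by
  have h := sum_psi_mul ψ hψ (∑ j, z j ^ 2 - 1)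
  simp only [sub_eq_zero] at h
  rw [← h, kap]
  have h3 : ∀ s : F, (if s = 0 then 0 else ψ (s * (∑ j, z j ^ 2 - 1)))
      = ψ (s * (∑ j, z j ^ 2 - 1)) - if s = 0 then 1 else 0 := by
    intro s; split_ifs with hs <;> simp [hs]
  rw [Finset.sum_congr rfl fun s _ => h3 s, Finset.sum_sub_distrib]
  simp

lemma kap_bound {F : Type} [Field F] [Fintype F] [DecidableEq F] (hodd : Odd (Fintype.card F))
    (ψ : AddChar F ℂ) (hψ : ψ ≠ 1) {d : ℕ} (m : Fin d → F) :
    ‖∑ z, kap ψ z * ψ (∑ j, m j * z j)‖ ^ 2 ≤ 4 * (Fintype.card F : ℝ) ^ (d + 1) := by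
  have hch := ringChar_ne_two_of_odd hodd
  have h1 : ∑ z, kap ψ z * ψ (∑ j, m j * z j) = gs ψ ^ d * ∑ s : F, if s = 0 then 0 else
      ((quadraticChar F s : ℤ) : ℂ) ^ d * ψ⁻¹ (s + (∑ j, m j ^ 2) / 4 / s) := by
    simp only [kap, Finset.sum_mul]
    rw [Finset.sum_comm, Finset.mul_sum]
    refine Finset.sum_congr rfl fun s _ => ?_
    split_ifs with hs
    · simp
    · have e1 : ∀ z : Fin d → F, ψ (s * (∑ j, z j ^ 2 - 1)) * ψ (∑ j, m j * z j)
          = ψ (-s) * ∏ j, ψ (s * z j ^ 2 + m j * z j) := by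
        intro z
        rw [← psi_sum_prod, ← AddChar.map_add_eq_mul, ← AddChar.map_add_eq_mul,
          Finset.sum_add_distrib, ← Finset.mul_sum]
        congr 1; ring
      have e2 : ∑ z : Fin d → F, ∏ j, ψ (s * z j ^ 2 + m j * z j) = ∏ j, ∑ a : F, ψ (s * a ^ 2 + m j * a) := by
        rw [Finset.prod_univ_sum, Fintype.piFinset_univ]
      rw [Finset.sum_congr rfl fun z _ => e1 z, ← Finset.mul_sum, e2,
        Finset.prod_congr rfl fun j _ => gauss_quad hch ψ hψ s (m j) hs, Finset.prod_mul_distrib,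
        ← psi_sum_prod, Finset.prod_const, Finset.card_univ, Fintype.card_fin, ← mul_assoc,
        ← AddChar.map_add_eq_mul, AddChar.inv_apply]
      have e3 : -s + ∑ j, -(m j ^ 2 / (4 * s)) = -(s + (∑ j, m j ^ 2) / 4 / s) := by
        rw [Finset.sum_neg_distrib, ← Finset.sum_div, div_div]; ring
      rw [e3, mul_pow]; ring
  rw [h1, norm_mul, mul_pow, norm_pow, ← pow_mul, mul_comm d 2, pow_mul, gs_norm hch ψ hψ]
  have := tw_bound hodd ψ⁻¹ (inv_ne_one.2 hψ) ((∑ j, m j ^ 2) / 4) d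
  calc _ ≤ (Fintype.card F : ℝ) ^ d * (4 * Fintype.card F) := mul_le_mul_of_nonneg_left this (by positivity)
    _ = _ := by ring

end

theorem statement7 {F : Type} [Field F] [Fintype F] [DecidableEq F]
    (q : ℕ) (hq : Fintype.card F = q) (hodd : Odd q)
    (d : ℕ) (hd : 2 ≤ d)
    (E : Finset (Fin d → F)) (k : ℕ) :
    ∃ R : ℝ,
      (chainCount E (2 * k + 1) : ℝ) = (q : ℝ)⁻¹ * (chainCount E k : ℝ) ^ 2 + R ∧
        |R| ≤ 2 * (q : ℝ) ^ (((d : ℝ) - 1) / 2) * (chainCount E (2 * k) : ℝ) := by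
  subst hq
  obtain ⟨ψ, hψ⟩ : ∃ ψ : AddChar F ℂ, ψ ≠ 1 := by
    obtain ⟨ψ, hψ⟩ := AddChar.exists_apply_ne_zero.2 (one_ne_zero : (1 : F) ≠ 0)
    exact ⟨ψ, fun h => hψ (by rw [h]; simp)⟩
  refine ⟨_, (add_sub_cancel _ _).symm, ?_⟩
  have hqp : (0 : ℝ) < Fintype.card F := by exact_mod_cast Fintype.card_pos
  set f := WW E k with hf
  have c2 : (chainCount E (2 * k) : ℝ) = ∑ x, f x * f x := by
    rw [chainCount_eq, two_mul, ← WW_add]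
  have c1 : (Fintype.card F : ℂ) * ((chainCount E (2 * k + 1) : ℝ) : ℂ)
      = (((chainCount E k : ℝ) ^ 2 : ℝ) : ℂ) + ∑ x, ∑ y, (f x : ℂ) * f y * kap ψ (x - y) := by
    have h1 : (((chainCount E k : ℝ) ^ 2 : ℝ) : ℂ) = ∑ x, ∑ y, (f x : ℂ) * f y := by
      rw [chainCount_eq, sq, Finset.sum_mul_sum]; push_cast; rfl
    rw [h1, ← Finset.sum_add_distrib, chainCount_eq, show 2 * k + 1 = k + (k + 1) by ring, ← WW_add,
      Complex.ofReal_sum, Finset.mul_sum]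
    refine Finset.sum_congr rfl fun x _ => ?_
    rw [← Finset.sum_add_distrib, WW, Finset.mul_sum, Complex.ofReal_sum, Finset.mul_sum]
    refine Finset.sum_congr rfl fun y _ => ?_
    have h2 := kap_eq ψ hψ (x - y)
    rw [show (f x : ℂ) * f y + (f x : ℂ) * f y * kap ψ (x - y) = (f x : ℂ) * f y * (1 + kap ψ (x - y)) by ring, h2]
    rw [← hf]
    by_cases hx : x ∈ E
    · by_cases hy : y ∈ E
      · simp only [hx, hy, true_and, Pi.sub_apply]
        split_ifs
        · push_cast; ring
        · simp
      · have : f y = 0 := WW_supp E k y hy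
        simp [this]
    · have : f x = 0 := WW_supp E k x hx
      simp [this]
  have hb := fourier_bound ψ hψ (kap ψ) (2 * (Fintype.card F : ℝ) ^ (((d : ℝ) + 1) / 2)) (fun m => by
    apply le_of_sq_le_sq _ (by positivity)
    refine (kap_bound hodd ψ hψ m).trans (le_of_eq ?_)
    rw [mul_pow, ← Real.rpow_natCast (_ ^ _) 2, ← Real.rpow_mul hqp.le, ← Real.rpow_natCast]
    push_cast
    rw [show ((d : ℝ) + 1) / 2 * 2 = d + 1 by ring]
    norm_num) f
  have h3 : ∑ x, ∑ y, (f x : ℂ) * f y * kap ψ (x - y) = (((Fintype.card F : ℝ) *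
      ((chainCount E (2 * k + 1) : ℝ) - (Fintype.card F : ℝ)⁻¹ * (chainCount E k : ℝ) ^ 2) : ℝ) : ℂ) := by
    rw [mul_sub, mul_inv_cancel_left₀ hqp.ne', Complex.ofReal_sub, Complex.ofReal_mul, Complex.ofReal_natCast, c1]
    ring
  rw [h3, Complex.norm_real, Real.norm_eq_abs, abs_mul, abs_of_pos hqp, ← c2] at hb
  have h4 : (Fintype.card F : ℝ) ^ (((d : ℝ) + 1) / 2) = Fintype.card F * (Fintype.card F : ℝ) ^ (((d : ℝ) - 1) / 2) := by
    rw [show ((d : ℝ) + 1) / 2 = 1 + ((d : ℝ) - 1) / 2 by ring, Real.rpow_add hqp, Real.rpow_one]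
  rw [h4] at hb
  apply le_of_mul_le_mul_left _ hqp
  refine hb.trans (le_of_eq ?_)
  ring
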